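/- arXiv:0811.4067 — 2 statements merged into one kernel-verified Lean document; each statement's English description precedes it below -/
import Mathlib

section
/- For every n ≥ 1 and all tuples I = (i_0,…,i_n), J = (j_0,…,j_n) ∈ ℕ^{n+1}, the determinant d_{I,J} is an eigenvector of the derivation p_{2,0,0}: namely p_{2,0,0}(d_{I,J}) = (−Σ_{r=0}^n i_r(i_r−1) + Σ_{s=0}^n (j_s+1)(j_s+2))·d_{I,J}. -/
open MvPolynomial

noncomputable section

/-- The polynomial ring `R = ℂ[Q_{a,b} : a,b ∈ ℕ]`. -/
abbrev RR : Type := MvPolynomial (ℕ × ℕ) ℂ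

/-- The coefficient `λ(a,b,w,l) = (−1)^{b+1}·(b+l)!/(l+w−a)!` if `l+w−a ≥ 0`, else `0`. -/
def lamC (a b : ℕ) (w : ℤ) (l : ℕ) : ℂ :=
  if 0 ≤ (l : ℤ) + w - a then
    (-1) ^ (b + 1) * (Nat.factorial (b + l) : ℂ) /
      (Nat.factorial ((l : ℤ) + w - a).toNat : ℂ)
  else 0

/-- The coefficient `μ(a,b,w,m) = (−1)^a·(a+m)!/(m+w−b)!` if `m+w−b ≥ 0`, else `0`. -/
def muC (a b : ℕ) (w : ℤ) (m : ℕ) : ℂ :=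
  if 0 ≤ (m : ℤ) + w - b then
    (-1) ^ a * (Nat.factorial (a + m) : ℂ) /
      (Nat.factorial ((m : ℤ) + w - b).toNat : ℂ)
  else 0

/-- The derivation `p_{a,b,w}` of `R` with
`p_{a,b,w}(Q_{l,m}) = λ(a,b,w,l)·Q_{l+w,m} + μ(a,b,w,m)·Q_{l,m+w}`, where a summand is
interpreted as `0` whenever its coefficient is `0` (a nonzero coefficient forces the
corresponding shifted index to be a nonnegative integer). -/
def pDer (a b : ℕ) (w : ℤ) : Derivation ℂ RR RR :=
  MvPolynomial.mkDerivation ℂ fun lm : ℕ × ℕ =>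
    lamC a b w lm.1 • X (((lm.1 : ℤ) + w).toNat, lm.2) +
      muC a b w lm.2 • X (lm.1, ((lm.2 : ℤ) + w).toNat)

/-- The determinant `d_{I,J}` of the `(n+1)×(n+1)` matrix with `(r,s)` entry `Q_{i_r,j_s}`. -/
def dDet (n : ℕ) (I J : Fin (n + 1) → ℕ) : RR :=
  Matrix.det (Matrix.of fun r s => (X (I r, J s) : RR))

theorem lamC_two (l : ℕ) : lamC 2 0 0 l = -((l : ℂ) * ((l : ℂ) - 1)) := by
  rcases l with _ | _ | l
  · simp [lamC]
  · simp [lamC]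
  · have h : (((l + 1 + 1 : ℕ) : ℤ) + 0 - (2 : ℕ)) = (l : ℤ) := by push_cast; ring
    unfold lamC
    rw [h, if_pos (by positivity), Int.toNat_natCast, Nat.zero_add (l + 1 + 1), Nat.factorial_succ,
      Nat.factorial_succ]
    have h0 : (Nat.factorial l : ℂ) ≠ 0 := by exact_mod_cast Nat.factorial_ne_zero l
    rw [div_eq_iff h0]
    push_cast
    ring

theorem muC_two (m : ℕ) : muC 2 0 0 m = ((m : ℂ) + 1) * ((m : ℂ) + 2) := by
  have h : ((m : ℤ) + 0 - (0 : ℕ)) = (m : ℤ) := by push_cast; ring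
  unfold muC
  rw [h, if_pos (by positivity), Int.toNat_natCast, Nat.add_comm 2 m, Nat.factorial_succ,
    Nat.factorial_succ]
  have h0 : (Nat.factorial m : ℂ) ≠ 0 := by exact_mod_cast Nat.factorial_ne_zero m
  rw [div_eq_iff h0]
  push_cast
  ring

theorem pDer_X (l m : ℕ) : pDer 2 0 0 (X (l, m) : RR) =
    (-((l : ℂ) * ((l : ℂ) - 1)) + ((m : ℂ) + 1) * ((m : ℂ) + 2)) • (X (l, m) : RR) := by
  rw [pDer, mkDerivation_X]
  simp only [lamC_two, muC_two, add_zero, Int.toNat_natCast]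
  rw [← add_smul]

theorem der_prod {ι : Type*} (D : Derivation ℂ RR RR) (f : ι → RR) (c : ι → ℂ)
    (h : ∀ i, D (f i) = c i • f i) (s : Finset ι) :
    D (∏ i ∈ s, f i) = (∑ i ∈ s, c i) • ∏ i ∈ s, f i := by
  classical
  induction s using Finset.induction_on with
  | empty => simp
  | insert a s ha ih =>
    rw [Finset.prod_insert ha, Finset.sum_insert ha, Derivation.leibniz, ih, h]
    simp only [smul_eq_mul, Algebra.smul_def, map_add]
    ring

/-- `d_{I,J}` is an eigenvector of `p_{2,0,0}` with eigenvalue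
`−Σ_r i_r(i_r−1) + Σ_s (j_s+1)(j_s+2)`. -/
theorem pDer_two_zero_zero_dDet (n : ℕ) (hn : 1 ≤ n) (I J : Fin (n + 1) → ℕ) :
    pDer 2 0 0 (dDet n I J) =
      (((-∑ r : Fin (n + 1), (I r : ℤ) * ((I r : ℤ) - 1)) +
        ∑ s : Fin (n + 1), ((J s : ℤ) + 1) * ((J s : ℤ) + 2) : ℤ) : ℂ) • dDet n I J := by
  unfold dDet
  rw [Matrix.det_apply, map_sum, Finset.smul_sum]
  refine Finset.sum_congr rfl fun σ _ => ?_
  simp only [Matrix.of_apply]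
  rw [Units.smul_def, map_zsmul, der_prod _ _ _ (fun i => pDer_X (I (σ i)) (J i)), smul_comm]
  congr 2
  rw [Finset.sum_add_distrib, Finset.sum_neg_distrib,
    Equiv.sum_comp σ (fun i => (I i : ℂ) * ((I i : ℂ) - 1))]
  push_cast
  rfl
end
end

section
/- For every n ≥ 1 and every integer b ≥ n+2, p_{0,b,1}(d_0) = (−1)^{b+1}·((b+n)!/(n+1)!)·d_{ι',ι}, where ι' = (0,1,…,n−1,n+1). -/
open MvPolynomial

noncomputable section

/-- The tuple `ι = (0,1,…,n)`. -/
def iot (n : ℕ) : Fin (n + 1) → ℕ := fun r => (r : ℕ)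

theorem der_prod_aux {ι : Type*} [DecidableEq ι] (D : Derivation ℂ RR RR) (s : Finset ι)
    (f : ι → RR) :
    D (∏ i ∈ s, f i) = ∑ i ∈ s, ∏ k ∈ s, (if k = i then D (f k) else f k) := by
  induction s using Finset.induction_on with
  | empty => simp
  | insert a s ha ih =>
    rw [Finset.prod_insert ha, Derivation.leibniz, ih, Finset.sum_insert ha,
      Finset.prod_insert ha, if_pos rfl, smul_eq_mul, smul_eq_mul, Finset.mul_sum, add_comm]
    congr 1
    · rw [mul_comm]
      congr 1
      apply Finset.prod_congr rfl
      intro k hk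
      rw [if_neg]
      rintro rfl
      exact ha hk
    · apply Finset.sum_congr rfl
      intro i hi
      rw [Finset.prod_insert ha, if_neg]
      rintro rfl
      exact ha hi

theorem der_det_aux {m : ℕ} (D : Derivation ℂ RR RR) (M : Matrix (Fin m) (Fin m) RR) :
    D M.det = ∑ i, (M.updateRow i (fun j => D (M i j))).det := by
  have h : ∀ N : Matrix (Fin m) (Fin m) RR,
      N.det = ∑ σ : Equiv.Perm (Fin m), Equiv.Perm.sign σ • ∏ i, N i (σ i) := by
    intro N
    rw [← Matrix.det_transpose, Matrix.det_apply]
    rfl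
  rw [h M, map_sum]
  simp_rw [h]
  rw [Finset.sum_comm]
  apply Finset.sum_congr rfl
  intro σ _
  rw [← Finset.smul_sum, Units.smul_def, Units.smul_def, map_zsmul, der_prod_aux]
  congr 1
  apply Finset.sum_congr rfl
  intro i _
  apply Finset.prod_congr rfl
  intro k _
  by_cases hk : k = i
  · subst hk; simp
  · simp [hk, Matrix.updateRow_ne hk]

/-- For `b ≥ n+2`: `p_{0,b,1}(d_0) = (−1)^{b+1}·((b+n)!/(n+1)!)·d_{ι',ι}`, where
`ι' = (0,1,…,n−1,n+1)`. -/
theorem pDer_zero_b_one_d0 (n : ℕ) (hn : 1 ≤ n) (b : ℕ) (hb : n + 2 ≤ b) :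
    pDer 0 b 1 (dDet n (iot n) (iot n)) =
      ((-1) ^ (b + 1) * (Nat.factorial (b + n) : ℂ) / (Nat.factorial (n + 1) : ℂ)) •
        dDet n (Function.update (iot n) (Fin.last n) (n + 1)) (iot n) := by
  unfold dDet
  rw [der_det_aux]
  have key : ∀ i j : Fin (n + 1),
      pDer 0 b 1 (X (iot n i, iot n j)) = lamC 0 b 1 i • X ((i : ℕ) + 1, (j : ℕ)) := by
    intro i j
    have hj := j.isLt
    have hmu : muC 0 b 1 (j : ℕ) = 0 := by
      unfold muC
      rw [if_neg]
      omega
    have ht : (((i : ℕ) : ℤ) + 1).toNat = (i : ℕ) + 1 := by omega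
    simp [pDer, MvPolynomial.mkDerivation_X, iot, hmu, ht]
  rw [Finset.sum_eq_single (Fin.last n)]
  · have hl : lamC 0 b 1 n = (-1) ^ (b + 1) * (Nat.factorial (b + n) : ℂ) / (Nat.factorial (n + 1) : ℂ) := by
      have ht : ((n : ℤ) + 1 - (0 : ℕ)).toNat = n + 1 := by omega
      unfold lamC
      rw [if_pos (by omega), ht]
    rw [← hl]
    have e : (fun j => pDer 0 b 1 ((Matrix.of fun r s => (X (iot n r, iot n s) : RR)) (Fin.last n) j))
        = (C (lamC 0 b 1 n) : RR) • fun j : Fin (n + 1) => (X (n + 1, (j : ℕ)) : RR) := by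
      funext j
      rw [Matrix.of_apply, key]
      simp [MvPolynomial.smul_eq_C_mul]
    rw [e, Matrix.det_updateRow_smul, MvPolynomial.smul_eq_C_mul]
    congr 2
    ext1 r s
    by_cases hr : r = Fin.last n
    · subst hr; simp [iot]
    · simp [hr, Matrix.updateRow_ne hr]
  · intro i _ hi
    have hlt : (i : ℕ) < n := Fin.val_lt_last hi
    let i' : Fin (n + 1) := ⟨(i : ℕ) + 1, by omega⟩
    have hne : i' ≠ i := by
      intro h
      have := congrArg Fin.val h
      simp [i'] at this
    have e : (fun j => pDer 0 b 1 ((Matrix.of fun r s => (X (iot n r, iot n s) : RR)) i j))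
        = (C (lamC 0 b 1 i) : RR) • fun j : Fin (n + 1) => (X ((i : ℕ) + 1, (j : ℕ)) : RR) := by
      funext j
      rw [Matrix.of_apply, key]
      simp [MvPolynomial.smul_eq_C_mul]
    rw [e, Matrix.det_updateRow_smul, Matrix.det_zero_of_row_eq hne.symm, mul_zero]
    rw [Matrix.updateRow_self, Matrix.updateRow_ne hne]
    funext j
    simp [iot, i']
  · simp
end
end
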